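/- arXiv:1703.00362 — 2 statements merged into one kernel-verified Lean document; each statement's English description precedes it below -/
import Mathlib

section
/- Let 0 ≤ α < 1/3. Then there exists a nonnegative function f : ℝ → ℝ of bounded variation (one may take f = n(χ_{[0,1/n]} + χ_{[1-1/n,1]}) for n sufficiently large) and a point x_α ∈ (1/3, 2/3) such that M^α f(x_α) = max_{x ∈ [1/3,2/3]} M^α f(x) > max( M^α f(1/3), M^α f(2/3) ), while M^α f(x) > f(x) for every x ∈ [1/3, 2/3]. In particular, M^α f has a local maximum at a point x_α where M^α f(x_α) > f(x_α). -/
open MeasureTheory Set Filter Topology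

/-- The average of `|f|` over the interval `[y - t, y + t]`. -/
noncomputable def avgAbs (f : ℝ → ℝ) (y t : ℝ) : ℝ :=
  (1 / (2 * t)) * ∫ s in (y - t)..(y + t), |f s|

/-- The nontangential Hardy–Littlewood maximal function. -/
noncomputable def ntMax (α : ℝ) (f : ℝ → ℝ) (x : ℝ) : ℝ :=
  sSup {r : ℝ | ∃ y t : ℝ, 0 < t ∧ |x - y| ≤ α * t ∧ r = avgAbs f y t}

/-- Two bumps of unit mass, on `(0, δ]` and on `(1 - δ, 1]`. -/
noncomputable def twoBumps (δ x : ℝ) : ℝ :=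
  (Ioc 0 δ).indicator (fun _ => δ⁻¹) x + (Ioc (1 - δ) 1).indicator (fun _ => δ⁻¹) x

lemma twoBumps_nonneg {δ : ℝ} (hδ : 0 < δ) (x : ℝ) : 0 ≤ twoBumps δ x :=
  add_nonneg (indicator_nonneg (fun _ _ => (inv_pos.2 hδ).le) _)
    (indicator_nonneg (fun _ _ => (inv_pos.2 hδ).le) _)

lemma BoundedVariationOn.comp_monotone_of_finite {β ι E : Type*} [LinearOrder β] [LinearOrder ι]
    [Finite ι] [PseudoMetricSpace E] (g : ι → E) {φ : β → ι} (hφ : Monotone φ) :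
    BoundedVariationOn (g ∘ φ) univ :=
  ne_top_of_le_ne_top (BoundedVariationOn.of_finite g univ)
    (eVariationOn.comp_le_of_monotoneOn g φ (hφ.monotoneOn _) (mapsTo_univ _ _))

lemma boundedVariationOn_twoBumps {δ : ℝ} (hδ : 0 < δ) (hδ2 : δ ≤ 1 / 2) :
    BoundedVariationOn (twoBumps δ) univ := by
  let φ : ℝ → Fin 5 := fun x =>
    if x ≤ 0 then 0 else if x ≤ δ then 1 else if x ≤ 1 - δ then 2 else if x ≤ 1 then 3 else 4
  have hφ : Monotone φ := by
    intro x y hxy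
    simp only [φ]
    split_ifs <;> first | decide | (exfalso; linarith)
  have hf : twoBumps δ = ![0, δ⁻¹, 0, δ⁻¹, 0] ∘ φ := by
    funext x
    simp only [twoBumps, φ, indicator, mem_Ioc, Function.comp]
    split_ifs <;> first | (exfalso; grind) | simp
  rw [hf]
  exact BoundedVariationOn.comp_monotone_of_finite _ hφ

lemma intervalIntegral_indicator_Ioc_const {a b : ℝ} (hab : a ≤ b) (c d r : ℝ) :
    ∫ s in a..b, (Ioc c d).indicator (fun _ => r) s = max (min b d - max a c) 0 * r := by
  rw [intervalIntegral.integral_of_le hab, setIntegral_indicator measurableSet_Ioc, Ioc_inter_Ioc,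
    setIntegral_const, Real.volume_real_Ioc, smul_eq_mul]

lemma intervalIntegrable_indicator_Ioc_const (a b c d r : ℝ) :
    IntervalIntegrable ((Ioc c d).indicator (fun _ => r)) volume a b := by
  rw [intervalIntegrable_iff]
  exact (integrableOn_const (by simp)).indicator measurableSet_Ioc

lemma avgAbs_twoBumps {δ : ℝ} (hδ : 0 < δ) {y t : ℝ} (ht : 0 < t) :
    avgAbs (twoBumps δ) y t =
      (max (min (y + t) δ - max (y - t) 0) 0 + max (min (y + t) 1 - max (y - t) (1 - δ)) 0) /
        (δ * (2 * t)) := by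
  simp only [avgAbs, abs_of_nonneg (twoBumps_nonneg hδ _)]
  simp only [twoBumps]
  rw [intervalIntegral.integral_add (intervalIntegrable_indicator_Ioc_const ..)
      (intervalIntegrable_indicator_Ioc_const ..),
    intervalIntegral_indicator_Ioc_const (by linarith),
    intervalIntegral_indicator_Ioc_const (by linarith)]
  field_simp

lemma avgAbs_twoBumps_of_subset {δ : ℝ} (hδ : 0 < δ) (hδ2 : δ ≤ 1 / 2) {y t : ℝ}
    (h0 : y - t ≤ 0) (h1 : 1 ≤ y + t) : avgAbs (twoBumps δ) y t = 1 / t := by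
  have ht : 0 < t := by linarith
  rw [avgAbs_twoBumps hδ ht, min_eq_right (by linarith), max_eq_right h0, min_eq_right h1,
    max_eq_right (by linarith : y - t ≤ 1 - δ), max_eq_left (by linarith),
    max_eq_left (by linarith)]
  field_simp
  ring

lemma bumpOverlap_le {δ : ℝ} (hδ : 0 < δ) (a b c : ℝ) :
    max (min b (c + δ) - max a c) 0 ≤ δ := by
  grind

lemma bumpOverlap_eq_zero_or {δ α c x y t : ℝ} (hα0 : 0 ≤ α) (hc : 0 < c)
    (hcδ : 1 + α ≤ 2 * c * (1 / 3 - δ)) (hx : x ∈ Icc (1 / 3 : ℝ) (2 / 3))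
    (hxy : |x - y| ≤ α * t) :
    (max (min (y + t) δ - max (y - t) 0) 0 = 0 ∨ 1 ≤ c * (2 * t)) ∧
      (max (min (y + t) 1 - max (y - t) (1 - δ)) 0 = 0 ∨ 1 ≤ c * (2 * t)) := by
  obtain ⟨h1, h2⟩ := abs_le.1 hxy
  have key : 1 / 3 - δ ≤ (1 + α) * t → 1 ≤ c * (2 * t) := by
    intro h
    have := mul_le_mul_of_nonneg_left h (by positivity : 0 ≤ 2 * c)
    by_contra! h3
    nlinarith
  constructor
  · by_cases h : y - t < δ
    · exact .inr (key (by linarith [hx.1]))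
    · left; grind
  · by_cases h : 1 - δ < y + t
    · exact .inr (key (by linarith [hx.2]))
    · left; grind

lemma bumpOverlap_add_le {δ a b : ℝ} (hδ : 0 < δ) (hδ2 : δ ≤ 1 / 2)
    (hA : max (min b δ - max a 0) 0 ≠ 0) (hB : max (min b 1 - max a (1 - δ)) 0 ≠ 0) :
    max (min b δ - max a 0) 0 + max (min b 1 - max a (1 - δ)) 0 ≤ 2 * (δ * (b - a)) := by
  have h1 : max (min b δ - max a 0) 0 ≤ δ - max a 0 := by grind
  have h2 : max (min b 1 - max a (1 - δ)) 0 ≤ δ - max (1 - b) 0 := by grind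
  have h3 : 1 - max a 0 - max (1 - b) 0 ≤ b - a := by grind
  have h4 : 0 ≤ max a 0 := le_max_right _ _
  have h5 : 0 ≤ max (1 - b) 0 := le_max_right _ _
  nlinarith

lemma avgAbs_twoBumps_le_two {δ α c x y t : ℝ} (hδ : 0 < δ) (hδ2 : δ ≤ 1 / 2) (hα0 : 0 ≤ α)
    (hc : 0 < c) (hc2 : c ≤ 2) (hcδ : 1 + α ≤ 2 * c * (1 / 3 - δ))
    (hx : x ∈ Icc (1 / 3 : ℝ) (2 / 3)) (ht : 0 < t) (hxy : |x - y| ≤ α * t) :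
    avgAbs (twoBumps δ) y t ≤ 2 := by
  rw [avgAbs_twoBumps hδ ht, div_le_iff₀ (by positivity)]
  obtain ⟨hA, hB⟩ := bumpOverlap_eq_zero_or hα0 hc hcδ hx hxy
  have hAB := bumpOverlap_add_le (a := y - t) (b := y + t) hδ hδ2
  have hA1 := bumpOverlap_le hδ (y - t) (y + t) 0
  have hB1 := bumpOverlap_le hδ (y - t) (y + t) (1 - δ)
  rw [zero_add] at hA1
  rw [sub_add_cancel] at hB1
  have hone : 1 ≤ c * (2 * t) → δ ≤ 2 * (δ * (2 * t)) := by
    intro h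
    nlinarith [mul_le_mul_of_nonneg_right hc2 ht.le]
  generalize max (min (y + t) δ - max (y - t) 0) 0 = A at *
  generalize max (min (y + t) 1 - max (y - t) (1 - δ)) 0 = B at *
  by_cases hA0 : A = 0
  · rcases hB with hB | hB
    · rw [hA0, hB, zero_add]; positivity
    · linarith [hone hB]
  · by_cases hB0 : B = 0
    · linarith [hone (hA.resolve_left hA0)]
    · linarith [hAB hA0 hB0]

lemma avgAbs_twoBumps_le_of_endpoint {δ α c x y t : ℝ} (hδ : 0 < δ) (hα0 : 0 ≤ α)
    (hc : 0 < c) (hcδ : 1 + α ≤ 2 * c * (1 / 3 - δ))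
    (hx : x = 1 / 3 ∨ x = 2 / 3) (ht : 0 < t) (hxy : |x - y| ≤ α * t) :
    avgAbs (twoBumps δ) y t ≤ c := by
  rw [avgAbs_twoBumps hδ ht, div_le_iff₀ (by positivity)]
  obtain ⟨hA, hB⟩ := bumpOverlap_eq_zero_or hα0 hc hcδ
    (by rcases hx with rfl | rfl <;> constructor <;> norm_num) hxy
  have hA1 := bumpOverlap_le hδ (y - t) (y + t) 0
  have hB1 := bumpOverlap_le hδ (y - t) (y + t) (1 - δ)
  rw [zero_add] at hA1
  rw [sub_add_cancel] at hB1
  have hone : 1 ≤ c * (2 * t) → δ ≤ c * (δ * (2 * t)) := by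
    intro h
    nlinarith
  have htwo (hA0 : max (min (y + t) δ - max (y - t) 0) 0 ≠ 0)
      (hB0 : max (min (y + t) 1 - max (y - t) (1 - δ)) 0 ≠ 0) : 2 ≤ c * (2 * t) := by
    obtain ⟨h1, h2⟩ := abs_le.1 hxy
    have h3 : y - t < δ := by grind
    have h4 : 1 - δ < y + t := by grind
    have h5 : 2 * (1 / 3 - δ) ≤ (1 + α) * t := by rcases hx with rfl | rfl <;> linarith
    have := mul_le_mul_of_nonneg_left h5 (by positivity : 0 ≤ 2 * c)
    by_contra! h6
    nlinarith
  generalize max (min (y + t) δ - max (y - t) 0) 0 = A at *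
  generalize max (min (y + t) 1 - max (y - t) (1 - δ)) 0 = B at *
  by_cases hA0 : A = 0
  · rcases hB with hB | hB
    · rw [hA0, hB, zero_add]; positivity
    · linarith [hone hB]
  · by_cases hB0 : B = 0
    · linarith [hone (hA.resolve_left hA0)]
    · nlinarith [htwo hA0 hB0]

lemma ntMax_le {α K x : ℝ} {f : ℝ → ℝ} (hα0 : 0 ≤ α)
    (h : ∀ y t, 0 < t → |x - y| ≤ α * t → avgAbs f y t ≤ K) : ntMax α f x ≤ K := by
  refine csSup_le ⟨_, x, 1, one_pos, by simpa using hα0, rfl⟩ ?_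
  rintro _ ⟨y, t, ht, hxy, rfl⟩
  exact h y t ht hxy

lemma avgAbs_le_ntMax {α K x y t : ℝ} {f : ℝ → ℝ}
    (h : ∀ y t, 0 < t → |x - y| ≤ α * t → avgAbs f y t ≤ K) (ht : 0 < t)
    (hxy : |x - y| ≤ α * t) : avgAbs f y t ≤ ntMax α f x := by
  refine le_csSup ⟨K, ?_⟩ ⟨y, t, ht, hxy, rfl⟩
  rintro _ ⟨z, s, hs, hxz, rfl⟩
  exact h z s hs hxz

/-- For `0 ≤ α < 1/3` there is a nonnegative function `f` of bounded variation and a point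
`x_α ∈ (1/3, 2/3)` at which `M^α f` attains its maximum over `[1/3, 2/3]`, strictly above the
values at the endpoints `1/3` and `2/3`, while `M^α f > f` on all of `[1/3, 2/3]`.
In particular, `M^α f` has a local maximum at a point where it detaches from `f`. -/
theorem ntMax_local_max_detached (α : ℝ) (hα0 : 0 ≤ α) (hα : α < 1 / 3) :
    ∃ f : ℝ → ℝ, (∀ x, 0 ≤ f x) ∧ BoundedVariationOn f Set.univ ∧
      ∃ xα ∈ Set.Ioo (1 / 3 : ℝ) (2 / 3),
        (∀ x ∈ Set.Icc (1 / 3 : ℝ) (2 / 3), ntMax α f x ≤ ntMax α f xα) ∧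
        max (ntMax α f (1 / 3)) (ntMax α f (2 / 3)) < ntMax α f xα ∧
        ∀ x ∈ Set.Icc (1 / 3 : ℝ) (2 / 3), f x < ntMax α f x := by
  obtain ⟨δ, hδ, hδα⟩ : ∃ δ : ℝ, 0 < δ ∧ 8 * δ = 1 / 3 - α :=
    ⟨(1 / 3 - α) / 8, by linarith, by ring⟩
  have hδ3 : 0 < 1 / 3 - δ := by linarith
  obtain ⟨c, hc, hc2, hcδ⟩ : ∃ c : ℝ, 0 < c ∧ c < 2 ∧ 1 + α ≤ 2 * c * (1 / 3 - δ) := by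
    refine ⟨(1 + α) / (2 * (1 / 3 - δ)), by positivity, ?_, ?_⟩
    · rw [div_lt_iff₀ (by positivity)]
      linarith
    · generalize 1 / 3 - δ = D at hδ3
      exact le_of_eq (by field_simp)
  have hδ2 : δ ≤ 1 / 2 := by linarith
  have hle {x : ℝ} (hx : x ∈ Icc (1 / 3 : ℝ) (2 / 3)) (y t : ℝ) (ht : 0 < t)
      (hxy : |x - y| ≤ α * t) : avgAbs (twoBumps δ) y t ≤ 2 :=
    avgAbs_twoBumps_le_two hδ hδ2 hα0 hc hc2.le hcδ hx ht hxy
  have hmid : 2 ≤ ntMax α (twoBumps δ) (1 / 2) := by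
    have h := avgAbs_le_ntMax (y := 1 / 2) (t := 1 / 2) (hle (x := 1 / 2) (by norm_num))
      (by norm_num) (by simpa using hα0)
    rw [avgAbs_twoBumps_of_subset hδ hδ2 (by norm_num) (by norm_num)] at h
    linarith
  have hend {x : ℝ} (hx : x = 1 / 3 ∨ x = 2 / 3) : ntMax α (twoBumps δ) x < 2 :=
    (ntMax_le hα0 fun y t ht hxy =>
      avgAbs_twoBumps_le_of_endpoint hδ hα0 hc hcδ hx ht hxy).trans_lt hc2
  refine ⟨twoBumps δ, twoBumps_nonneg hδ, boundedVariationOn_twoBumps hδ hδ2, 1 / 2,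
    by norm_num, fun x hx => (ntMax_le hα0 (hle hx)).trans hmid,
    (max_lt (hend (.inl rfl)) (hend (.inr rfl))).trans_le hmid, fun x hx => ?_⟩
  have hfx : twoBumps δ x = 0 := by
    obtain ⟨h1, h2⟩ := hx
    rw [twoBumps, indicator_of_notMem fun h => by linarith [h.2],
      indicator_of_notMem fun h => by linarith [h.1], add_zero]
  have h := avgAbs_le_ntMax (hle hx) one_pos (y := x) (by simpa using hα0)
  rw [avgAbs_twoBumps_of_subset hδ hδ2 (by linarith [hx.2]) (by linarith [hx.1])] at h
  rw [hfx]
  linarith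
end

section
/- Let N : ℝ → (0,∞) be a function with Lipschitz constant Lip(N) ≤ 1/2. Then for every f : ℝ → ℝ of bounded variation, V(M^1_N f) ≤ V(f). -/
open MeasureTheory Set Filter Topology NNReal ENNReal

/-- The `N`-truncated uncentered Hardy–Littlewood maximal function
`M^1_N f (x) = sup { (1/(2t)) ∫_{y-t}^{y+t} |f| : 0 < t, |x - y| ≤ t ≤ N(x) }`. -/
noncomputable def truncMax (N : ℝ → ℝ) (f : ℝ → ℝ) (x : ℝ) : ℝ :=
  sSup {r : ℝ | ∃ y t : ℝ, 0 < t ∧ |x - y| ≤ t ∧ t ≤ N x ∧ r = avgAbs f y t}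

theorem le_of_forall_between_le {p q c d : ℝ} (hp : p < c) (hq : q < c)
    (h : ∀ A, p < A → q < A → A < c → A ≤ d) : c ≤ d := by
  by_contra! hd
  obtain ⟨A, hA, hAc⟩ := exists_between (max_lt (max_lt hp hq) hd)
  simp only [max_lt_iff] at hA
  exact hA.2.not_ge (h A hA.1.1 hA.1.2 hAc)

/-- A finite variation sum of `M` is controlled by any Jordan-type majorant `V` of `g`, provided
that `g` takes values below `M x` just to the right of `x`, and values close to `M x` between
points where `M` is smaller. -/
theorem sum_abs_sub_le_of_test_points {g M V : ℝ → ℝ} {T : ℝ}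
    (hV : ∀ ⦃y y'⦄, y ≤ y' → |g y' - g y| ≤ V y' - V y) (hV0 : ∀ y, 0 ≤ V y)
    (hVT : ∀ y, V y ≤ T)
    (hlow : ∀ ⦃x y⦄, x < y → ∃ z ∈ Ioo x y, g z ≤ M x)
    (hleft : ∀ ⦃u x A⦄, u < x → M u < A → A < M x → ∃ y, u < y ∧ A ≤ g y)
    (hright : ∀ ⦃x w A⦄, x < w → M w < A → A < M x → ∃ y, y < w ∧ A ≤ g y)
    (hmid : ∀ ⦃u x w A⦄, u < x → x < w → M u < A → M w < A → A < M x →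
      ∃ y ∈ Ioo u w, A ≤ g y)
    {x : ℕ → ℝ} (hx : Monotone x) (n : ℕ) :
    ∑ i ∈ Finset.range n, |M (x (i + 1)) - M (x i)| ≤ T := by
  have hP : ∀ ⦃y y'⦄, y ≤ y' → V y + g y ≤ V y' + g y' := fun y y' h ↦ by
    linarith [(abs_le.1 (hV h)).1]
  have hQ : ∀ ⦃y y'⦄, y ≤ y' → V y - g y ≤ V y' - g y' := fun y y' h ↦ by
    linarith [(abs_le.1 (hV h)).2]
  suffices H : (∀ y, x n < y →
        ∑ i ∈ Finset.range n, |M (x (i + 1)) - M (x i)| - M (x n) ≤ V y - g y) ∧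
      (∀ w, x n < w → M w < M (x n) →
        ∑ i ∈ Finset.range n, |M (x (i + 1)) - M (x i)| + M (x n) ≤ V w + g w) ∧
      ∑ i ∈ Finset.range n, |M (x (i + 1)) - M (x i)| ≤ T from H.2.2
  induction n with
  | zero =>
    simp only [Finset.range_zero, Finset.sum_empty, zero_sub, zero_add]
    refine ⟨fun y hy ↦ ?_, fun w hw hMw ↦ ?_, (hV0 0).trans (hVT 0)⟩
    · obtain ⟨z, hz, hgz⟩ := hlow hy
      linarith [hQ hz.2.le, hV0 z]
    · refine le_of_forall_between_le hMw hMw fun A hA _ hA' ↦ ?_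
      obtain ⟨y, hy, hgy⟩ := hright hw hA hA'
      linarith [hP hy.le, hV0 y]
  | succ k ih =>
    obtain ⟨ihQ, ihP, ihT⟩ := ih
    rw [Finset.sum_range_succ]
    set S := ∑ i ∈ Finset.range k, |M (x (i + 1)) - M (x i)|
    have hle : x k ≤ x (k + 1) := hx k.le_succ
    rcases lt_trichotomy (M (x (k + 1))) (M (x k)) with h | h | h
    · have hlt : x k < x (k + 1) := hle.lt_of_ne fun e ↦ by simp [e] at h
      rw [abs_of_neg (by linarith)]
      have hPk := ihP _ hlt h
      refine ⟨fun y hy ↦ ?_, fun w hw hMw ↦ ?_, ?_⟩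
      · obtain ⟨z, hz, hgz⟩ := hlow hy
        linarith [hQ hz.2.le, hP hz.1.le]
      · linarith [hP hw.le]
      · obtain ⟨z, hz, hgz⟩ := hlow (lt_add_one (x (k + 1)))
        linarith [hP hz.1.le, hVT z]
    · rw [h, sub_self, abs_zero, add_zero]
      exact ⟨fun y hy ↦ ihQ y (hle.trans_lt hy), fun w hw hMw ↦ ihP w (hle.trans_lt hw) hMw, ihT⟩
    · have hlt : x k < x (k + 1) := hle.lt_of_ne fun e ↦ by simp [e] at h
      rw [abs_of_pos (by linarith)]
      refine ⟨fun y hy ↦ ?_, fun w hw hMw ↦ ?_, ?_⟩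
      · linarith [ihQ y (hlt.trans hy)]
      · have key : M (x (k + 1)) ≤ (V w + g w - (S - M (x k))) / 2 := by
          refine le_of_forall_between_le h hMw fun A hA hA' hA'' ↦ ?_
          obtain ⟨y, hy, hgy⟩ := hmid hlt hw hA hA' hA''
          linarith [hP hy.2.le, ihQ y hy.1]
        linarith
      · have key : M (x (k + 1)) ≤ T - (S - M (x k)) := by
          refine le_of_forall_between_le h h fun A hA _ hA'' ↦ ?_
          obtain ⟨y, hy, hgy⟩ := hleft hlt hA hA''
          linarith [ihQ y hy, hVT y]
        linarith

theorem exists_mem_Ioo_pos_of_integral_pos {h : ℝ → ℝ} {a b : ℝ} (hab : a ≤ b)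
    (hpos : 0 < ∫ s in a..b, h s) : ∃ y ∈ Ioo a b, 0 < h y := by
  by_contra! hcon
  rw [intervalIntegral.integral_of_le hab, integral_Ioc_eq_integral_Ioo] at hpos
  exact hpos.not_ge (setIntegral_nonpos measurableSet_Ioo hcon)

section Truncated

variable {N f : ℝ → ℝ}

theorem avgAbs_eq_of_midpoint {a b : ℝ} :
    avgAbs f ((a + b) / 2) ((b - a) / 2) = (∫ s in a..b, |f s|) / (b - a) := by
  unfold avgAbs
  rw [show (a + b) / 2 - (b - a) / 2 = a by ring, show (a + b) / 2 + (b - a) / 2 = b by ring,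
    show 2 * ((b - a) / 2) = b - a by ring, one_div_mul_eq_div]

theorem bddAbove_truncMax {B : ℝ} (hB : ∀ x, |f x| ≤ B) (x : ℝ) :
    BddAbove {r : ℝ | ∃ y t : ℝ, 0 < t ∧ |x - y| ≤ t ∧ t ≤ N x ∧ r = avgAbs f y t} := by
  refine ⟨B, ?_⟩
  rintro r ⟨y, t, ht, -, -, rfl⟩
  have h := intervalIntegral.norm_integral_le_of_norm_le_const (a := y - t) (b := y + t)
    (f := fun s ↦ |f s|) (C := B) fun s _ ↦ by simpa using hB s
  rw [show y + t - (y - t) = 2 * t by ring, abs_of_pos (by positivity : 0 < 2 * t)] at h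
  rw [avgAbs, one_div_mul_eq_div, div_le_iff₀ (by positivity)]
  exact (le_abs_self _).trans h

theorem integral_abs_le_truncMax_mul {B : ℝ} (hB : ∀ x, |f x| ≤ B) {a b x : ℝ}
    (ha : a ≤ x) (hb : x ≤ b) (hN : b - a ≤ 2 * N x) :
    ∫ s in a..b, |f s| ≤ truncMax N f x * (b - a) := by
  rcases (ha.trans hb).eq_or_lt with rfl | hab
  · simp
  rw [← div_le_iff₀ (sub_pos.2 hab), ← avgAbs_eq_of_midpoint]
  refine le_csSup (bddAbove_truncMax hB x) ⟨_, _, by linarith, ?_, by linarith, rfl⟩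
  rw [abs_le]
  constructor <;> linarith

theorem exists_lt_integral_abs_of_lt_truncMax (hN : ∀ x, 0 < N x) {x A : ℝ}
    (hA : A < truncMax N f x) :
    ∃ a b, a ≤ x ∧ x ≤ b ∧ b - a ≤ 2 * N x ∧ A * (b - a) < ∫ s in a..b, |f s| := by
  have hne : {r : ℝ | ∃ y t : ℝ, 0 < t ∧ |x - y| ≤ t ∧ t ≤ N x ∧ r = avgAbs f y t}.Nonempty :=
    ⟨_, x, N x, hN x, by simpa using (hN x).le, le_rfl, rfl⟩
  obtain ⟨_, ⟨y, t, ht, hxy, htN, rfl⟩, hlt⟩ := exists_lt_of_lt_csSup hne hA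
  rw [avgAbs, one_div_mul_eq_div, lt_div_iff₀ (by positivity)] at hlt
  rw [abs_le] at hxy
  refine ⟨y - t, y + t, by linarith, by linarith, by linarith, ?_⟩
  rwa [show y + t - (y - t) = 2 * t by ring]

theorem exists_le_truncMax (hN : ∀ x, 0 < N x) {B : ℝ} (hB : ∀ x, |f x| ≤ B)
    (hint : ∀ a b, IntervalIntegrable (fun s ↦ |f s|) volume a b) {x y : ℝ} (hxy : x < y) :
    ∃ z ∈ Ioo x y, |f z| ≤ truncMax N f x := by
  by_contra! hcon
  set t := min (y - x) (2 * N x)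
  have ht : 0 < t := lt_min (by linarith) (by linarith [hN x])
  have ht' : x + t ≤ y := by linarith [min_le_left (y - x) (2 * N x)]
  have hpos := intervalIntegral.intervalIntegral_pos_of_pos_on
    ((hint x (x + t)).sub intervalIntegrable_const)
    (fun s hs ↦ sub_pos.2 (hcon s ⟨hs.1, hs.2.trans_le ht'⟩)) (lt_add_of_pos_right x ht)
  have hle := integral_abs_le_truncMax_mul (N := N) hB le_rfl (lt_add_of_pos_right x ht).le
    (by linarith [min_le_right (y - x) (2 * N x)])
  rw [intervalIntegral.integral_sub (hint _ _) intervalIntegrable_const,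
    intervalIntegral.integral_const, smul_eq_mul] at hpos
  linarith

/-- A near-optimal interval for `x` retains a large value of `|f|` after it is cut off at points
where the maximal function is smaller; this is where the Lipschitz bound on `N` enters. -/
theorem exists_interval_of_lt_truncMax (hN : ∀ x, 0 < N x)
    (hLip : LipschitzWith (1 / 2 : ℝ≥0) N) {B : ℝ} (hB : ∀ x, |f x| ≤ B)
    (hint : ∀ a b, IntervalIntegrable (fun s ↦ |f s|) volume a b) {x A : ℝ}
    (hA : A < truncMax N f x) :
    ∃ a b, a ≤ x ∧ x ≤ b ∧ ∀ c d, a ≤ c → c ≤ x → x ≤ d → d ≤ b →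
      (c = a ∨ truncMax N f c < A) → (d = b ∨ truncMax N f d < A) →
      ∃ y ∈ Ioo c d, A ≤ |f y| := by
  obtain ⟨a, b, ha, hb, hlen, hlt⟩ := exists_lt_integral_abs_of_lt_truncMax hN hA
  refine ⟨a, b, ha, hb, fun c d hac hcx hxd hdb hl hr ↦ ?_⟩
  have hLip' : ∀ u, 2 * N x ≤ 2 * N u + |x - u| := fun u ↦ by
    have h := hLip.dist_le_mul x u
    rw [Real.dist_eq, Real.dist_eq] at h
    push_cast at h
    linarith [le_abs_self (N x - N u)]
  have hleft : ∫ s in a..c, |f s| ≤ A * (c - a) := by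
    rcases hl with rfl | hl
    · simp
    · have h := hLip' c
      rw [abs_of_nonneg (by linarith)] at h
      exact (integral_abs_le_truncMax_mul hB hac le_rfl (by linarith)).trans
        (mul_le_mul_of_nonneg_right hl.le (by linarith))
  have hright : ∫ s in d..b, |f s| ≤ A * (b - d) := by
    rcases hr with rfl | hr
    · simp
    · have h := hLip' d
      rw [abs_of_nonpos (by linarith)] at h
      exact (integral_abs_le_truncMax_mul hB le_rfl hdb (by linarith)).trans
        (mul_le_mul_of_nonneg_right hr.le (by linarith))
  have hsplit : (∫ s in a..c, |f s|) + (∫ s in c..d, |f s|) + ∫ s in d..b, |f s| =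
      ∫ s in a..b, |f s| := by
    rw [intervalIntegral.integral_add_adjacent_intervals (hint _ _) (hint _ _),
      intervalIntegral.integral_add_adjacent_intervals (hint _ _) (hint _ _)]
  obtain ⟨y, hy, hAy⟩ := exists_mem_Ioo_pos_of_integral_pos (h := fun s ↦ |f s| - A)
    (hcx.trans hxd) (by
      rw [intervalIntegral.integral_sub (hint _ _) intervalIntegrable_const,
        intervalIntegral.integral_const, smul_eq_mul]
      linarith)
  exact ⟨y, hy, (sub_pos.1 hAy).le⟩

end Truncated

theorem BoundedVariationOn.intervalIntegrable_abs {f : ℝ → ℝ}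
    (hf : BoundedVariationOn f Set.univ) (a b : ℝ) :
    IntervalIntegrable (fun s ↦ |f s|) volume a b := by
  obtain ⟨p, q, hp, hq, rfl⟩ :=
    hf.locallyBoundedVariationOn.exists_monotoneOn_sub_monotoneOn
  exact ((monotoneOn_univ.1 hp).intervalIntegrable.sub (monotoneOn_univ.1 hq).intervalIntegrable).abs

theorem BoundedVariationOn.abs_sub_le_toReal_eVariationOn_Iic_sub {f : ℝ → ℝ}
    (hf : BoundedVariationOn f Set.univ) {y z : ℝ} (h : y ≤ z) :
    |f z - f y| ≤ (eVariationOn f (Iic z)).toReal - (eVariationOn f (Iic y)).toReal := by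
  have hadd := eVariationOn.add_le_union f (s := Iic y) (t := Icc y z)
    fun _ hs _ ht ↦ le_trans hs ht.1
  rw [Iic_union_Icc_eq_Iic h] at hadd
  have hedist : edist (f z) (f y) ≤ eVariationOn f (Icc y z) :=
    eVariationOn.edist_le f ⟨h, le_rfl⟩ ⟨le_rfl, h⟩
  have hy : eVariationOn f (Iic y) ≠ ⊤ := hf.mono (subset_univ _)
  have hz : eVariationOn f (Iic z) ≠ ⊤ := hf.mono (subset_univ _)
  have := ENNReal.toReal_mono hz ((add_le_add_right hedist _).trans hadd)
  rw [ENNReal.toReal_add hy (edist_ne_top _ _), ← dist_edist, Real.dist_eq] at this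
  linarith

/-- If `N : ℝ → (0, ∞)` has Lipschitz constant at most `1/2`, then for every function `f`
of bounded variation, `V(M^1_N f) ≤ V(f)`. -/
theorem variation_truncMax_le (N : ℝ → ℝ) (hNpos : ∀ x, 0 < N x)
    (hLip : LipschitzWith (1 / 2 : ℝ≥0) N) (f : ℝ → ℝ)
    (hf : BoundedVariationOn f Set.univ) :
    eVariationOn (truncMax N f) Set.univ ≤ eVariationOn f Set.univ := by
  have hB : ∀ x, |f x| ≤ |f 0| + (eVariationOn f Set.univ).toReal := fun x ↦ by
    have h := hf.dist_le (mem_univ x) (mem_univ 0)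
    rw [Real.dist_eq] at h
    linarith [abs_sub_abs_le_abs_sub (f x) (f 0)]
  have hint := hf.intervalIntegrable_abs
  refine iSup_le fun ⟨n, x, hx, _⟩ ↦ ?_
  rw [← ENNReal.ofReal_toReal hf]
  simp_rw [edist_dist, Real.dist_eq]
  rw [← ENNReal.ofReal_sum_of_nonneg fun _ _ ↦ abs_nonneg _]
  refine ENNReal.ofReal_le_ofReal (sum_abs_sub_le_of_test_points (g := fun s ↦ |f s|)
    (V := fun y ↦ (eVariationOn f (Iic y)).toReal) (fun y z h ↦ ?_)
    (fun _ ↦ ENNReal.toReal_nonneg)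
    (fun _ ↦ ENNReal.toReal_mono hf (eVariationOn.mono f (subset_univ _)))
    (fun u v huv ↦ exists_le_truncMax hNpos hB hint huv) ?_ ?_ ?_ hx n)
  · exact (abs_abs_sub_abs_le_abs_sub _ _).trans (hf.abs_sub_le_toReal_eVariationOn_Iic_sub h)
  · intro u x A hu hMu hA
    obtain ⟨a, b, ha, hb, H⟩ := exists_interval_of_lt_truncMax hNpos hLip hB hint hA
    obtain ⟨y, hy, hAy⟩ := H (max a u) b (le_max_left _ _) (max_le ha hu.le) hb le_rfl
      ((max_choice a u).imp_right fun e ↦ by rwa [e]) (Or.inl rfl)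
    exact ⟨y, (le_max_right _ _).trans_lt hy.1, hAy⟩
  · intro x w A hw hMw hA
    obtain ⟨a, b, ha, hb, H⟩ := exists_interval_of_lt_truncMax hNpos hLip hB hint hA
    obtain ⟨y, hy, hAy⟩ := H a (min b w) le_rfl ha (le_min hb hw.le) (min_le_left _ _)
      (Or.inl rfl) ((min_choice b w).imp_right fun e ↦ by rwa [e])
    exact ⟨y, hy.2.trans_le (min_le_right _ _), hAy⟩
  · intro u x w A hu hw hMu hMw hA
    obtain ⟨a, b, ha, hb, H⟩ := exists_interval_of_lt_truncMax hNpos hLip hB hint hA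
    obtain ⟨y, hy, hAy⟩ := H (max a u) (min b w) (le_max_left _ _) (max_le ha hu.le)
      (le_min hb hw.le) (min_le_left _ _) ((max_choice a u).imp_right fun e ↦ by rwa [e])
      ((min_choice b w).imp_right fun e ↦ by rwa [e])
    exact ⟨y, ⟨(le_max_right _ _).trans_lt hy.1, hy.2.trans_le (min_le_right _ _)⟩, hAy⟩
end
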